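/- Let I ⊂ K[x_1,x_2] be a monomial ideal with minimal monomial generating set G(I) = {x_1^{a_1}x_2^{b_1}, x_1^{a_2}x_2^{b_2}, …, x_1^{a_m}x_2^{b_m}}, where a_1 > a_2 > ⋯ > a_m ≥ 0 and 0 ≤ b_1 < b_2 < ⋯ < b_m. Then slength(I) = min{a_i + b_i − a_m − b_1 : 1 ≤ i ≤ m} + 1. -/

import Mathlib

open MvPolynomial

/-- The set of exponent vectors of the monomials in the Stanley space `x^u · K[Z]`. -/
def stanleySet {σ : Type} (u : σ →₀ ℕ) (Z : Set σ) : Set (σ →₀ ℕ) :=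
  {w | ∃ v : σ →₀ ℕ, ↑v.support ⊆ Z ∧ w = u + v}

/-- A Stanley decomposition (partition into Stanley spaces) of a set `P` of
exponent vectors of monomials.  By the standard correspondence, Stanley
decompositions of a multigraded `K`-vector subquotient of `S` spanned by the
monomials with exponents in `P` correspond exactly to such partitions. -/
structure StanleyPartition {σ : Type} (P : Set (σ →₀ ℕ)) where
  r : ℕ
  base : Fin r → σ →₀ ℕ
  vars : Fin r → Set σ
  cover : P = ⋃ i, stanleySet (base i) (vars i)
  disj : ∀ i j, i ≠ j → Disjoint (stanleySet (base i) (vars i)) (stanleySet (base j) (vars j))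

/-- The Stanley length of `P`: the minimal length of a Stanley decomposition. -/
noncomputable def slength {σ : Type} (P : Set (σ →₀ ℕ)) : ℕ :=
  sInf {r | ∃ D : StanleyPartition P, D.r = r}

/-- The set of exponent vectors of the monomials belonging to an ideal. -/
def monSet {σ K : Type} [Field K] (I : Ideal (MvPolynomial σ K)) : Set (σ →₀ ℕ) :=
  {d | (monomial d (1 : K) : MvPolynomial σ K) ∈ I}

/-- `I` is a monomial ideal. -/
def IsMonomialIdeal {σ K : Type} [Field K] (I : Ideal (MvPolynomial σ K)) : Prop :=
  ∃ A : Set (σ →₀ ℕ), I = Ideal.span ((fun d => (monomial d (1 : K) : MvPolynomial σ K)) '' A)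

/-- Exponent vectors of the minimal monomial generators of `I`. -/
def minGens {σ K : Type} [Field K] (I : Ideal (MvPolynomial σ K)) : Set (σ →₀ ℕ) :=
  {d | d ∈ monSet I ∧ ∀ e ∈ monSet I, e ≤ d → e = d}

/-- The exponent vector of `x₁ ^ x * x₂ ^ y`. -/
noncomputable def planePoint (x y : ℕ) : Fin 2 →₀ ℕ :=
  Finsupp.single 0 x + Finsupp.single 1 y

@[simp] lemma planePoint_zero (x y : ℕ) : planePoint x y 0 = x := by
  simp [planePoint]

@[simp] lemma planePoint_one (x y : ℕ) : planePoint x y 1 = y := by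
  simp [planePoint]

lemma mem_stanleySet_iff {σ : Type} {u w : σ →₀ ℕ} {Z : Set σ} :
    w ∈ stanleySet u Z ↔ u ≤ w ∧ ∀ i, i ∉ Z → w i = u i := by
  constructor
  · rintro ⟨v, hv, rfl⟩
    refine ⟨le_self_add, fun i hi => ?_⟩
    have : v i = 0 := by
      by_contra h
      exact hi (hv (by simpa using h))
    simp [this]
  · rintro ⟨h, hZ⟩
    refine ⟨w - u, fun i hi => ?_, (add_tsub_cancel_of_le h).symm⟩
    by_contra hn
    simp [hZ i hn] at hi

lemma mem_stanleySet_fin_two_iff {u w : Fin 2 →₀ ℕ} {Z : Set (Fin 2)} :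
    w ∈ stanleySet u Z ↔
      (u 0 ≤ w 0 ∧ u 1 ≤ w 1) ∧ (0 ∉ Z → w 0 = u 0) ∧ (1 ∉ Z → w 1 = u 1) := by
  rw [mem_stanleySet_iff, Finsupp.le_def, Fin.forall_fin_two, Fin.forall_fin_two]

lemma monSet_mono {σ K : Type} [Field K] {I : Ideal (MvPolynomial σ K)} {d e : σ →₀ ℕ}
    (hd : d ∈ monSet I) (hde : d ≤ e) : e ∈ monSet I := by
  obtain ⟨c, rfl⟩ := exists_add_of_le hde
  have h := I.mul_mem_right (monomial c (1 : K)) hd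
  rwa [monomial_mul, one_mul] at h

lemma mem_monSet_iff_exists_minGens_le {σ K : Type} [Finite σ] [Field K]
    {I : Ideal (MvPolynomial σ K)} {w : σ →₀ ℕ} :
    w ∈ monSet I ↔ ∃ d ∈ minGens I, d ≤ w := by
  constructor
  · intro hw
    obtain ⟨d, hdw, hd⟩ := exists_minimal_le_of_wellFoundedLT (· ∈ monSet I) w hw
    exact ⟨d, ⟨hd.1, fun e he hed => le_antisymm hed (hd.2 he hed)⟩, hdw⟩
  · rintro ⟨d, hd, hdw⟩
    exact monSet_mono hd.1 hdw

/-- Any infinite family of points meets some part of a Stanley partition twice. -/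
lemma StanleyPartition.exists_ne_mem {σ : Type} {P : Set (σ →₀ ℕ)} (D : StanleyPartition P)
    (f : ℕ → σ →₀ ℕ) (hf : ∀ n, f n ∈ P) :
    ∃ i, ∃ n n', n ≠ n' ∧ f n ∈ stanleySet (D.base i) (D.vars i) ∧
      f n' ∈ stanleySet (D.base i) (D.vars i) := by
  have h : ∀ n, ∃ i, f n ∈ stanleySet (D.base i) (D.vars i) := fun n => by
    have := hf n
    rw [D.cover] at this
    simpa using this
  choose g hg using h
  obtain ⟨n, n', hne, heq⟩ := Finite.exists_ne_map_eq_of_infinite g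
  exact ⟨g n, n, n', hne, hg n, heq ▸ hg n'⟩

lemma exists_stanleyPartition_card {σ ι : Type} [Fintype ι] {P : Set (σ →₀ ℕ)} (base : ι → σ →₀ ℕ)
    (vars : ι → Set σ) (hcover : ∀ w, w ∈ P ↔ ∃ i, w ∈ stanleySet (base i) (vars i))
    (hdisj : ∀ i j w, w ∈ stanleySet (base i) (vars i) →
      w ∈ stanleySet (base j) (vars j) → i = j) :
    ∃ D : StanleyPartition P, D.r = Fintype.card ι := by
  let e := (Fintype.equivFin ι).symm
  refine ⟨⟨Fintype.card ι, base ∘ e, vars ∘ e, ?_, ?_⟩, rfl⟩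
  · ext w
    simp only [Set.mem_iUnion, Function.comp_apply, hcover]
    exact e.symm.exists_congr_left
  · intro i j hij
    exact Set.disjoint_left.2 fun w hi hj => hij (e.injective (hdisj _ _ w hi hj))

section Staircase

variable {m : ℕ} {a b : Fin (m + 1) → ℕ} {P : Set (Fin 2 →₀ ℕ)}

/-- Each of the sections of a staircase region is a ray, so a corner `(a i, b i)` gives a
decomposition into a quadrant, vertical rays to its left, and horizontal rays below it. -/
lemma exists_stanleyPartition_of_staircase (ha : StrictAnti a) (hb : StrictMono b)
    (hP : ∀ w, w ∈ P ↔ ∃ i, a i ≤ w 0 ∧ b i ≤ w 1) (i : Fin (m + 1)) :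
    ∃ D : StanleyPartition P, D.r = a i + b i - a (Fin.last m) - b 0 + 1 := by
  have hal : a (Fin.last m) ≤ a i := ha.antitone (Fin.le_last i)
  have hb0 : b 0 ≤ b i := hb.monotone (Fin.zero_le i)
  have hcol : ∀ x, ∃ h, a (Fin.last m) ≤ x → ∀ y, (∃ j, a j ≤ x ∧ b j ≤ y) ↔ h ≤ y := by
    intro x
    refine ⟨sInf {y | ∃ j, a j ≤ x ∧ b j ≤ y}, fun hx y => ⟨fun h => Nat.sInf_le h, fun h => ?_⟩⟩
    obtain ⟨j, h1, h2⟩ := Nat.sInf_mem (s := {y | ∃ j, a j ≤ x ∧ b j ≤ y})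
      ⟨b (Fin.last m), Fin.last m, hx, le_rfl⟩
    exact ⟨j, h1, h2.trans h⟩
  have hrow : ∀ y, ∃ g, b 0 ≤ y → ∀ x, (∃ j, a j ≤ x ∧ b j ≤ y) ↔ g ≤ x := by
    intro y
    refine ⟨sInf {x | ∃ j, a j ≤ x ∧ b j ≤ y}, fun hy x => ⟨fun h => Nat.sInf_le h, fun h => ?_⟩⟩
    obtain ⟨j, h1, h2⟩ := Nat.sInf_mem (s := {x | ∃ j, a j ≤ x ∧ b j ≤ y})
      ⟨a 0, 0, le_rfl, hy⟩
    exact ⟨j, h1.trans h, h2⟩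
  choose h hh using hcol
  choose g hg using hrow
  have key : ∀ x y, (∃ j, a j ≤ x ∧ b j ≤ y) →
      a (Fin.last m) ≤ x ∧ b 0 ≤ y ∧ (x < a i → b i ≤ y) := by
    rintro x y ⟨j, hx, hy⟩
    refine ⟨(ha.antitone (Fin.le_last j)).trans hx, (hb.monotone (Fin.zero_le j)).trans hy,
      fun hxi => ?_⟩
    exact (hb (ha.lt_iff_gt.1 (hx.trans_lt hxi))).le.trans hy
  let base : Option (Fin (a i - a (Fin.last m)) ⊕ Fin (b i - b 0)) → Fin 2 →₀ ℕ
    | none => planePoint (a i) (b i)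
    | some (.inl k) => planePoint (a (Fin.last m) + k) (h (a (Fin.last m) + k))
    | some (.inr k) => planePoint (g (b 0 + k)) (b 0 + k)
  let vars : Option (Fin (a i - a (Fin.last m)) ⊕ Fin (b i - b 0)) → Set (Fin 2)
    | none => Set.univ
    | some (.inl _) => {1}
    | some (.inr _) => {0}
  have hnone : ∀ w, w ∈ stanleySet (base none) (vars none) ↔ a i ≤ w 0 ∧ b i ≤ w 1 := by
    intro w
    simp [base, vars, mem_stanleySet_fin_two_iff]
  have hinl : ∀ k w, w ∈ stanleySet (base (some (.inl k))) (vars (some (.inl k))) ↔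
      w 0 = a (Fin.last m) + k ∧ ∃ j, a j ≤ w 0 ∧ b j ≤ w 1 := by
    intro k w
    have := hh (a (Fin.last m) + k) (Nat.le_add_right _ _) (w 1)
    simp only [base, vars, mem_stanleySet_fin_two_iff, planePoint_zero, planePoint_one]
    constructor
    · rintro ⟨⟨-, h2⟩, h3, -⟩
      have h0 := h3 (by simp)
      exact ⟨h0, h0 ▸ this.2 h2⟩
    · rintro ⟨h0, h1⟩
      rw [h0] at h1
      exact ⟨⟨h0.ge, this.1 h1⟩, fun _ => h0, by simp⟩
  have hinr : ∀ k w, w ∈ stanleySet (base (some (.inr k))) (vars (some (.inr k))) ↔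
      w 1 = b 0 + k ∧ ∃ j, a j ≤ w 0 ∧ b j ≤ w 1 := by
    intro k w
    have := hg (b 0 + k) (Nat.le_add_right _ _) (w 0)
    simp only [base, vars, mem_stanleySet_fin_two_iff, planePoint_zero, planePoint_one]
    constructor
    · rintro ⟨⟨h2, -⟩, -, h3⟩
      have h0 := h3 (by simp)
      exact ⟨h0, h0 ▸ this.2 h2⟩
    · rintro ⟨h0, h1⟩
      rw [h0] at h1
      exact ⟨⟨this.1 h1, h0.ge⟩, by simp, fun _ => h0⟩
  refine Exists.imp (fun D hD => hD.trans ?_)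
    (exists_stanleyPartition_card (P := P) base vars ?_ ?_)
  rotate_right
  · simp only [Fintype.card_option, Fintype.card_sum, Fintype.card_fin]
    omega
  · intro w
    simp only [Option.exists, Sum.exists, hnone, hinl, hinr, hP]
    constructor
    · intro hw
      obtain ⟨h1, h2, h3⟩ := key _ _ hw
      by_cases hx : w 0 < a i
      · exact Or.inr (Or.inl ⟨⟨w 0 - a (Fin.last m), by omega⟩, by simp; omega, hw⟩)
      by_cases hy : w 1 < b i
      · exact Or.inr (Or.inr ⟨⟨w 1 - b 0, by omega⟩, by simp; omega, hw⟩)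
      exact Or.inl ⟨not_lt.1 hx, not_lt.1 hy⟩
    · rintro (hw | ⟨k, -, hw⟩ | ⟨k, -, hw⟩)
      exacts [⟨i, hw⟩, hw, hw]
  · rintro (_ | k | k) (_ | l | l) w hw hw' <;> simp only [hnone, hinl, hinr] at hw hw'
    · rfl
    · omega
    · omega
    · omega
    · have : k = l := Fin.ext (by omega)
      rw [this]
    · have := (key _ _ hw.2).2.2 (by omega)
      omega
    · omega
    · have := (key _ _ hw.2).2.2 (by omega)
      omega
    · have : k = l := Fin.ext (by omega)
      rw [this]

/-- A Stanley partition of a staircase region contains a quadrant, and a separate ray for every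
column to the left of the quadrant and every row below it. -/
lemma StanleyPartition.exists_le_r_of_staircase (ha : StrictAnti a) (hb : StrictMono b)
    (hP : ∀ w, w ∈ P ↔ ∃ i, a i ≤ w 0 ∧ b i ≤ w 1) (D : StanleyPartition P) :
    ∃ i, a i + b i - a (Fin.last m) - b 0 + 1 ≤ D.r := by
  obtain ⟨k, n, n', hne, hn, hn'⟩ := D.exists_ne_mem
    (fun n => planePoint (a 0 + n) (b 0 + n)) (fun n => (hP _).2 ⟨0, by simp, by simp⟩)
  simp only [mem_stanleySet_fin_two_iff, planePoint_zero, planePoint_one] at hn hn'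
  have hk0 : 0 ∈ D.vars k := by
    by_contra hc
    have := hn.2.1 hc
    have := hn'.2.1 hc
    omega
  have hk1 : 1 ∈ D.vars k := by
    by_contra hc
    have := hn.2.2 hc
    have := hn'.2.2 hc
    omega
  have huniq : ∀ l, 0 ∈ D.vars l → 1 ∈ D.vars l → l = k := by
    intro l h0 h1
    by_contra hlk
    refine Set.disjoint_left.1 (D.disj l k hlk)
      (?_ : planePoint (D.base l 0 + D.base k 0) (D.base l 1 + D.base k 1) ∈ _) ?_
    · simp [mem_stanleySet_fin_two_iff, h0, h1]
    · simp [mem_stanleySet_fin_two_iff, hk0, hk1]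
  have hcol : ∀ x : Fin (D.base k 0 - a (Fin.last m)), ∃ l, 0 ∉ D.vars l ∧ 1 ∈ D.vars l ∧
      D.base l 0 = a (Fin.last m) + x := by
    intro x
    obtain ⟨l, n, n', hne, hn, hn'⟩ := D.exists_ne_mem
      (fun n => planePoint (a (Fin.last m) + x) (b (Fin.last m) + n))
      (fun n => (hP _).2 ⟨Fin.last m, by simp, by simp⟩)
    simp only [mem_stanleySet_fin_two_iff, planePoint_zero, planePoint_one] at hn hn'
    have h1 : 1 ∈ D.vars l := by
      by_contra hc
      have := hn.2.2 hc
      have := hn'.2.2 hc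
      omega
    have h0 : 0 ∉ D.vars l := by
      intro hc
      obtain rfl := huniq l hc h1
      omega
    exact ⟨l, h0, h1, (hn.2.1 h0).symm⟩
  have hrow : ∀ y : Fin (D.base k 1 - b 0), ∃ l, 0 ∈ D.vars l ∧ 1 ∉ D.vars l ∧
      D.base l 1 = b 0 + y := by
    intro y
    obtain ⟨l, n, n', hne, hn, hn'⟩ := D.exists_ne_mem
      (fun n => planePoint (a 0 + n) (b 0 + y))
      (fun n => (hP _).2 ⟨0, by simp, by simp⟩)
    simp only [mem_stanleySet_fin_two_iff, planePoint_zero, planePoint_one] at hn hn'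
    have h0 : 0 ∈ D.vars l := by
      by_contra hc
      have := hn.2.1 hc
      have := hn'.2.1 hc
      omega
    have h1 : 1 ∉ D.vars l := by
      intro hc
      obtain rfl := huniq l h0 hc
      omega
    exact ⟨l, h0, h1, (hn.2.2 h1).symm⟩
  choose c hc0 hc1 hc using hcol
  choose d hd0 hd1 hd using hrow
  let f : Option (Fin (D.base k 0 - a (Fin.last m)) ⊕ Fin (D.base k 1 - b 0)) → Fin D.r
    | none => k
    | some (.inl x) => c x
    | some (.inr y) => d y
  have hf : Function.Injective f := by
    rintro (_ | x | y) (_ | x' | y') hxy <;> simp only [f] at hxy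
    · rfl
    · exact absurd (hxy ▸ hk0) (hc0 x')
    · exact absurd (hxy ▸ hk1) (hd1 y')
    · exact absurd (hxy ▸ hk0) (hc0 x)
    · have h1 := hc x
      rw [hxy, hc x'] at h1
      have : x = x' := Fin.ext (by omega)
      rw [this]
    · exact absurd (hxy ▸ hd0 y') (hc0 x)
    · exact absurd (hxy ▸ hk1) (hd1 y)
    · exact absurd (hxy ▸ hd0 y) (hc0 x')
    · have h1 := hd y
      rw [hxy, hd y'] at h1
      have : y = y' := Fin.ext (by omega)
      rw [this]
  have hcard := Fintype.card_le_of_injective f hf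
  simp only [Fintype.card_option, Fintype.card_sum, Fintype.card_fin] at hcard
  have hmem : D.base k ∈ P := by
    refine D.cover.symm.subset (Set.mem_iUnion.2 ⟨k, ?_⟩)
    simp [mem_stanleySet_fin_two_iff]
  obtain ⟨i, h1, h2⟩ := (hP _).1 hmem
  have hal : a (Fin.last m) ≤ a i := ha.antitone (Fin.le_last i)
  have hb0 : b 0 ≤ b i := hb.monotone (Fin.zero_le i)
  exact ⟨i, by omega⟩

end Staircase

/-- For a monomial ideal `I ⊂ K[x_1,x_2]` with minimal
generators `x_1^{a_i} x_2^{b_i}`, `i = 0,…,m`, where `a` is strictly decreasing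
and `b` is strictly increasing,
`slength(I) = min{a_i + b_i − a_m − b_0} + 1`. -/
theorem stmt_7 {K : Type} [Field K] {m : ℕ} (a b : Fin (m + 1) → ℕ)
    (ha : StrictAnti a) (hb : StrictMono b)
    (I : Ideal (MvPolynomial (Fin 2) K)) (hmon : IsMonomialIdeal I)
    (hG : minGens I = Set.range (fun i : Fin (m + 1) =>
      Finsupp.single (0 : Fin 2) (a i) + Finsupp.single (1 : Fin 2) (b i))) :
    slength (monSet I) =
      sInf {t | ∃ i : Fin (m + 1), t = a i + b i - a (Fin.last m) - b 0} + 1 := by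
  have hP : ∀ w, w ∈ monSet I ↔ ∃ i, a i ≤ w 0 ∧ b i ≤ w 1 := by
    intro w
    rw [mem_monSet_iff_exists_minGens_le, hG]
    simp [Finsupp.le_def, Fin.forall_fin_two]
  obtain ⟨i, hi⟩ := Nat.sInf_mem
    (s := {t | ∃ i : Fin (m + 1), t = a i + b i - a (Fin.last m) - b 0}) ⟨_, 0, rfl⟩
  obtain ⟨D, hD⟩ := exists_stanleyPartition_of_staircase ha hb hP i
  apply le_antisymm
  · rw [hi]
    exact Nat.sInf_le ⟨D, hD⟩
  · refine le_csInf ⟨_, D, rfl⟩ ?_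
    rintro _ ⟨E, rfl⟩
    obtain ⟨j, hj⟩ := E.exists_le_r_of_staircase ha hb hP
    exact (Nat.add_le_add_right (Nat.sInf_le (by exact ⟨j, rfl⟩)) 1).trans hj
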